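/- For every n ≥ 2, the dcpo (Ωⁿ, ⊑) is exact: for every ρ ∈ Ωⁿ, the set ⇓ρ := {τ ∈ Ωⁿ : τ ≪ ρ} is directed and has supremum ρ. -/

import Mathlib

open scoped ComplexOrder Matrix

/-- The Bayesian order on Δⁿ (symmetric characterization). -/
def bayesLE {n : ℕ} (x y : Fin n → ℝ) : Prop :=
  ∃ σ : Equiv.Perm (Fin n),
    Antitone (fun i => x (σ i)) ∧ Antitone (fun i => y (σ i)) ∧
    ∀ i j : Fin n, (i : ℕ) + 1 = (j : ℕ) →
      x (σ i) * y (σ j) ≤ x (σ j) * y (σ i)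

/-- Ωⁿ : density matrices on ℂⁿ. -/
def IsDensityMatrix (n : ℕ) (ρ : Matrix (Fin n) (Fin n) ℂ) : Prop :=
  ρ.PosSemidef ∧ ρ.trace = 1

def QState (n : ℕ) := {ρ : Matrix (Fin n) (Fin n) ℂ // IsDensityMatrix n ρ}

/-- The spectral order on density matrices. -/
def specLE {n : ℕ} (ρ σ : Matrix (Fin n) (Fin n) ℂ) : Prop :=
  ∃ U : Matrix (Fin n) (Fin n) ℂ, U ∈ Matrix.unitaryGroup (Fin n) ℂ ∧
    (Uᴴ * ρ * U).IsDiag ∧ (Uᴴ * σ * U).IsDiag ∧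
    bayesLE (fun i => ((Uᴴ * ρ * U) i i).re) (fun i => ((Uᴴ * σ * U) i i).re)

def qLE {n : ℕ} (ρ σ : QState n) : Prop := specLE ρ.val σ.val

/-- `a` is the supremum (least upper bound) of `S` with respect to `le`. -/
def IsLub' {α : Type*} (le : α → α → Prop) (S : Set α) (a : α) : Prop :=
  (∀ s ∈ S, le s a) ∧ ∀ b, (∀ s ∈ S, le s b) → le a b

/-- `x ≪ y` : for every (nonempty) directed `S` with supremum `y`
there is `s ∈ S` with `x ⊑ s`. -/
def WayBelow {α : Type*} (le : α → α → Prop) (x y : α) : Prop :=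
  ∀ S : Set α, S.Nonempty → DirectedOn le S → IsLub' le S y → ∃ s ∈ S, le x s

/-- diagonal real vector conjugated by a unitary -/
noncomputable def conjD {n : ℕ} (U : Matrix (Fin n) (Fin n) ℂ) (x : Fin n → ℝ) :
    Matrix (Fin n) (Fin n) ℂ := U * Matrix.diagonal (fun i => (x i : ℂ)) * Uᴴ

/-- sorted probability vectors -/
def SortedProb {n : ℕ} (x : Fin n → ℝ) : Prop :=
  Antitone x ∧ (∀ i, 0 ≤ x i) ∧ ∑ i, x i = 1

/-- condition on data representing a comparable pair -/
def GoodData {n : ℕ} (U : Matrix (Fin n) (Fin n) ℂ) (x y : Fin n → ℝ) : Prop :=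
  U ∈ Matrix.unitaryGroup (Fin n) ℂ ∧ SortedProb x ∧ SortedProb y ∧
    ∀ i j, i ≤ j → x i * y j ≤ x j * y i

def RR {n : ℕ} (ρ σ : Matrix (Fin n) (Fin n) ℂ) : Prop :=
  ∃ U x y, GoodData U x y ∧ ρ = conjD U x ∧ σ = conjD U y

lemma chain {n : ℕ} {x y : Fin n → ℝ} (hx : SortedProb x) (hy : SortedProb y)
    (h : ∀ i j : Fin n, (i : ℕ) + 1 = (j : ℕ) → x i * y j ≤ x j * y i) :
    ∀ i j, i ≤ j → x i * y j ≤ x j * y i := by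
  have key : ∀ (k : ℕ) (i j : Fin n), (i : ℕ) + k = j → x i * y j ≤ x j * y i := by
    intro k
    induction k with
    | zero =>
      intro i j hij
      have : i = j := Fin.ext (by simpa using hij)
      subst this; exact le_rfl
    | succ k ih =>
      intro i j hij
      have hlt : (i : ℕ) + k < n := by have := j.2; omega
      let m : Fin n := ⟨i + k, hlt⟩
      have h1 := ih i m rfl
      have h2 := h m j (by simp [m]; omega)
      have hmj : m ≤ j := by rw [Fin.le_def]; simp [m]; omega
      rcases (hy.2.1 m).eq_or_lt with h0 | h0
      · have : y j = 0 := le_antisymm (h0 ▸ hy.1 hmj) (hy.2.1 j)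
        rw [this, mul_zero]
        exact mul_nonneg (hx.2.1 j) (hy.2.1 i)
      · have a := mul_le_mul_of_nonneg_right h1 (hy.2.1 j)
        have b := mul_le_mul_of_nonneg_right h2 (hy.2.1 i)
        refine le_of_mul_le_mul_right ?_ h0
        nlinarith
  intro i j hij
  exact key (j - i) i j (by have : (i : ℕ) ≤ j := hij; omega)

lemma unit_left {n : ℕ} {U : Matrix (Fin n) (Fin n) ℂ} (hU : U ∈ Matrix.unitaryGroup (Fin n) ℂ) :
    Uᴴ * U = 1 := Matrix.mem_unitaryGroup_iff'.1 hU

lemma unit_right {n : ℕ} {U : Matrix (Fin n) (Fin n) ℂ} (hU : U ∈ Matrix.unitaryGroup (Fin n) ℂ) :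
    U * Uᴴ = 1 := Matrix.mem_unitaryGroup_iff.1 hU

lemma unconj {n : ℕ} {U : Matrix (Fin n) (Fin n) ℂ} (hU : U ∈ Matrix.unitaryGroup (Fin n) ℂ)
    (x : Fin n → ℝ) : Uᴴ * conjD U x * U = Matrix.diagonal (fun i => (x i : ℂ)) := by
  have h := unit_left hU
  calc Uᴴ * (U * Matrix.diagonal (fun i => (x i : ℂ)) * Uᴴ) * U
      = (Uᴴ * U) * Matrix.diagonal (fun i => (x i : ℂ)) * (Uᴴ * U) := by
        simp only [Matrix.mul_assoc]
    _ = _ := by rw [h]; simp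

lemma conjD_of {n : ℕ} {U ρ : Matrix (Fin n) (Fin n) ℂ} (hU : U ∈ Matrix.unitaryGroup (Fin n) ℂ)
    (x : Fin n → ℝ) (h : Uᴴ * ρ * U = Matrix.diagonal (fun i => (x i : ℂ))) : ρ = conjD U x := by
  have h2 := unit_right hU
  rw [conjD, ← h]
  calc ρ = (U * Uᴴ) * ρ * (U * Uᴴ) := by rw [h2]; simp
    _ = _ := by simp only [Matrix.mul_assoc]

lemma trace_conjD {n : ℕ} {U : Matrix (Fin n) (Fin n) ℂ} (hU : U ∈ Matrix.unitaryGroup (Fin n) ℂ)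
    (x : Fin n → ℝ) : (conjD U x).trace = ((∑ i, x i : ℝ) : ℂ) := by
  rw [conjD, Matrix.trace_mul_comm, ← Matrix.mul_assoc, unit_left hU]
  simp [Matrix.trace]

lemma sorted_conj {n : ℕ} {ρ : Matrix (Fin n) (Fin n) ℂ} (hρ : IsDensityMatrix n ρ)
    {U : Matrix (Fin n) (Fin n) ℂ} (hU : U ∈ Matrix.unitaryGroup (Fin n) ℂ)
    (hd : (Uᴴ * ρ * U).IsDiag) (hs : Antitone (fun i => ((Uᴴ * ρ * U) i i).re)) :
    SortedProb (fun i => ((Uᴴ * ρ * U) i i).re) ∧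
      ρ = conjD U (fun i => ((Uᴴ * ρ * U) i i).re) := by
  have hp : (Uᴴ * ρ * U).PosSemidef := hρ.1.conjTranspose_mul_mul_same U
  have hnn : ∀ i, 0 ≤ (Uᴴ * ρ * U) i i := fun i => hp.diag_nonneg
  have heq : ρ = conjD U (fun i => ((Uᴴ * ρ * U) i i).re) := by
    apply conjD_of hU
    ext i j
    by_cases hij : i = j
    · subst hij
      rw [Matrix.diagonal_apply_eq]
      have := Complex.nonneg_iff.1 (hnn i)
      apply Complex.ext <;> simp
      exact this.2.symm
    · rw [Matrix.diagonal_apply_ne _ hij]; exact hd hij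
  refine ⟨⟨hs, fun i => (Complex.nonneg_iff.1 (hnn i)).1, ?_⟩, heq⟩
  have h1 := hρ.2
  rw [heq, trace_conjD hU] at h1
  exact_mod_cast h1

lemma RR_of_specLE {n : ℕ} {ρ σ : Matrix (Fin n) (Fin n) ℂ} (hρ : IsDensityMatrix n ρ)
    (hσ : IsDensityMatrix n σ) (h : specLE ρ σ) : RR ρ σ := by
  obtain ⟨U, hU, h1, h2, p, a1, a2, a3⟩ := h
  have key : ∀ A : Matrix (Fin n) (Fin n) ℂ,
      (U.submatrix id p)ᴴ * A * (U.submatrix id p) = (Uᴴ * A * U).submatrix p p := by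
    intro A; ext i j; simp [Matrix.mul_apply]
  have hW : U.submatrix id p ∈ Matrix.unitaryGroup (Fin n) ℂ := by
    rw [Matrix.mem_unitaryGroup_iff']
    have := key 1
    rw [Matrix.mul_one, Matrix.mul_one, unit_left hU, Matrix.submatrix_one_equiv] at this
    exact this
  have d1 : ((U.submatrix id p)ᴴ * ρ * (U.submatrix id p)).IsDiag := by
    rw [key]; exact h1.submatrix p.injective
  have d2 : ((U.submatrix id p)ᴴ * σ * (U.submatrix id p)).IsDiag := by
    rw [key]; exact h2.submatrix p.injective
  obtain ⟨s1, e1⟩ := sorted_conj hρ hW d1 (by rw [key]; exact a1)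
  obtain ⟨s2, e2⟩ := sorted_conj hσ hW d2 (by rw [key]; exact a2)
  refine ⟨_, _, _, ⟨hW, s1, s2, chain s1 s2 ?_⟩, e1, e2⟩
  rw [key, key]; exact a3

lemma specLE_of_RR {n : ℕ} {ρ σ : Matrix (Fin n) (Fin n) ℂ} (h : RR ρ σ) : specLE ρ σ := by
  obtain ⟨U, x, y, ⟨hU, hx, hy, hxy⟩, rfl, rfl⟩ := h
  refine ⟨U, hU, ?_, ?_, ?_⟩
  · rw [unconj hU]; exact Matrix.isDiag_diagonal _
  · rw [unconj hU]; exact Matrix.isDiag_diagonal _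
  · rw [unconj hU, unconj hU]
    refine ⟨1, ?_, ?_, ?_⟩
    · simpa using hx.1
    · simpa using hy.1
    · intro i j hij
      simpa using hxy i j (by rw [Fin.le_def]; omega)

lemma RR_refl {n : ℕ} {ρ : Matrix (Fin n) (Fin n) ℂ} (hρ : IsDensityMatrix n ρ) : RR ρ ρ := by
  apply RR_of_specLE hρ hρ
  have hH := hρ.1.isHermitian
  have hU := hH.eigenvectorUnitary.2
  have e : ((hH.eigenvectorUnitary : Matrix (Fin n) (Fin n) ℂ))ᴴ * ρ *
      (hH.eigenvectorUnitary : Matrix (Fin n) (Fin n) ℂ) =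
      Matrix.diagonal (fun i => (hH.eigenvalues i : ℂ)) := by
    have := unconj hU hH.eigenvalues
    rw [← this]
    congr 2
    exact hH.spectral_theorem
  refine ⟨_, hU, ?_, ?_, Tuple.sort (fun i => - hH.eigenvalues i), ?_, ?_, ?_⟩
  · rw [e]; exact Matrix.isDiag_diagonal _
  · rw [e]; exact Matrix.isDiag_diagonal _
  · rw [e]
    have := Tuple.monotone_sort (fun i => - hH.eigenvalues i)
    intro i j hij
    simpa using this hij
  · rw [e]
    have := Tuple.monotone_sort (fun i => - hH.eigenvalues i)
    intro i j hij
    simpa using this hij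
  · intro i j _
    exact (mul_comm _ _).le

lemma conjD_isDensity {n : ℕ} {U : Matrix (Fin n) (Fin n) ℂ}
    (hU : U ∈ Matrix.unitaryGroup (Fin n) ℂ) {x : Fin n → ℝ} (hx : SortedProb x) :
    IsDensityMatrix n (conjD U x) := by
  refine ⟨?_, ?_⟩
  · apply Matrix.PosSemidef.mul_mul_conjTranspose_same
    exact Matrix.PosSemidef.diagonal (fun i => by
      simpa using hx.2.1 i)
  · rw [trace_conjD hU, hx.2.2]; simp

/-- trace inequality -/
lemma cheb {n : ℕ} {x y : Fin n → ℝ} (hx : SortedProb x) (hy : SortedProb y)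
    (h : ∀ i j, i ≤ j → x i * y j ≤ x j * y i) : ∑ i, x i * x i ≤ ∑ i, x i * y i := by
  have h0 : 0 ≤ ∑ i, ∑ j, (x i - x j) * (y i * x j - y j * x i) := by
    refine Finset.sum_nonneg fun i _ => Finset.sum_nonneg fun j _ => ?_
    rcases le_total i j with hij | hij
    · have := h i j hij
      have := hx.1 hij
      apply mul_nonneg <;> linarith
    · have := h j i hij
      have := hx.1 hij
      apply mul_nonneg_of_nonpos_of_nonpos <;> linarith
  have e : ∑ i, ∑ j, (x i - x j) * (y i * x j - y j * x i) =
      ∑ i, ∑ j, ((x i * y i) * x j - (x i * x i) * y j - y i * (x j * x j) + x i * (x j * y j)) := by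
    refine Finset.sum_congr rfl fun i _ => Finset.sum_congr rfl fun j _ => by ring
  rw [e] at h0
  simp only [Finset.sum_add_distrib, Finset.sum_sub_distrib, ← Finset.mul_sum, ← Finset.sum_mul,
    hx.2.2, hy.2.2] at h0
  linarith

/-- sum of squared moduli -/
noncomputable def NN {n : ℕ} (M : Matrix (Fin n) (Fin n) ℂ) : ℝ := ∑ i, ∑ j, ‖M i j‖ ^ 2

lemma NN_conjD {n : ℕ} {U : Matrix (Fin n) (Fin n) ℂ} (hU : U ∈ Matrix.unitaryGroup (Fin n) ℂ)
    (x : Fin n → ℝ) : NN (conjD U x) = ∑ i, x i * x i := by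
  have h1 : (conjD U x) * (conjD U x)ᴴ = conjD U (fun i => x i * x i) := by
    have := unit_left hU
    have h3 : (conjD U x)ᴴ = conjD U x := by
      simp [conjD, Matrix.conjTranspose_mul, Matrix.diagonal_conjTranspose, Matrix.mul_assoc]
      congr 3
      ext i; simp
    rw [h3]
    calc U * Matrix.diagonal (fun i => (x i : ℂ)) * Uᴴ * (U * Matrix.diagonal (fun i => (x i : ℂ)) * Uᴴ)
       = U * (Matrix.diagonal (fun i => (x i : ℂ)) * (Uᴴ * U) * Matrix.diagonal (fun i => (x i : ℂ))) * Uᴴ := by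
          simp only [Matrix.mul_assoc]
     _ = _ := by rw [this]; simp [conjD]
  have h2 := congrArg Matrix.trace h1
  rw [trace_conjD hU] at h2
  have h4 : ((conjD U x) * (conjD U x)ᴴ).trace = ((NN (conjD U x) : ℝ) : ℂ) := by
    simp [NN, Matrix.trace, Matrix.mul_apply, Complex.mul_conj, Complex.normSq_eq_norm_sq]
  rw [h4] at h2
  exact_mod_cast h2

lemma conjD_sub {n : ℕ} (U : Matrix (Fin n) (Fin n) ℂ) (x y : Fin n → ℝ) :
    conjD U y - conjD U x = conjD U (fun i => y i - x i) := by
  simp only [conjD, ← Matrix.sub_mul, ← Matrix.mul_sub, Matrix.diagonal_sub, Complex.ofReal_sub]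

lemma RR_NN {n : ℕ} {s z : Matrix (Fin n) (Fin n) ℂ} (h : RR s z) :
    NN (z - s) ≤ NN z - NN s := by
  obtain ⟨U, x, y, ⟨hU, hx, hy, hxy⟩, rfl, rfl⟩ := h
  rw [conjD_sub, NN_conjD hU, NN_conjD hU, NN_conjD hU]
  have := cheb hx hy hxy
  have e : ∑ i, (y i - x i) * (y i - x i) = ∑ i, y i * y i - 2 * ∑ i, x i * y i + ∑ i, x i * x i := by
    rw [Finset.mul_sum, ← Finset.sum_sub_distrib, ← Finset.sum_add_distrib]
    exact Finset.sum_congr rfl fun i _ => by ring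
  linarith

lemma NN_zero {n : ℕ} {M : Matrix (Fin n) (Fin n) ℂ} (h : NN M ≤ 0) : M = 0 := by
  ext i j
  have h1 : ‖M i j‖ ^ 2 ≤ NN M :=
    (Finset.single_le_sum (f := fun j => ‖M i j‖ ^ 2) (fun _ _ => by positivity)
      (Finset.mem_univ j)).trans
    (Finset.single_le_sum (f := fun i => ∑ j, ‖M i j‖ ^ 2) (fun _ _ => by positivity)
      (Finset.mem_univ i))
  have : ‖M i j‖ ^ 2 = 0 := le_antisymm (h1.trans h) (by positivity)
  simpa using this

lemma NN_nonneg {n : ℕ} (M : Matrix (Fin n) (Fin n) ℂ) : 0 ≤ NN M := by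
  unfold NN; positivity

lemma entry_le_NN {n : ℕ} (M : Matrix (Fin n) (Fin n) ℂ) (i j : Fin n) : ‖M i j‖ ^ 2 ≤ NN M :=
    (Finset.single_le_sum (f := fun j => ‖M i j‖ ^ 2) (fun _ _ => by positivity)
      (Finset.mem_univ j)).trans
    (Finset.single_le_sum (f := fun i => ∑ j, ‖M i j‖ ^ 2) (fun _ _ => by positivity)
      (Finset.mem_univ i))

lemma RR_antisymm {n : ℕ} {s z : Matrix (Fin n) (Fin n) ℂ} (h : RR s z) (h' : RR z s) :
    s = z := by
  have h1 := RR_NN h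
  have h2 := RR_NN h'
  have := NN_nonneg (s - z)
  have := NN_nonneg (z - s)
  have h3 : z - s = 0 := NN_zero (by linarith)
  exact (sub_eq_zero.1 h3).symm

lemma unitary_entry {n : ℕ} {U : Matrix (Fin n) (Fin n) ℂ}
    (hU : U ∈ Matrix.unitaryGroup (Fin n) ℂ) (i j : Fin n) : ‖U i j‖ ≤ 1 :=
  entry_norm_bound_of_unitary hU i j

lemma sorted_le_one {n : ℕ} {x : Fin n → ℝ} (hx : SortedProb x) (i : Fin n) : x i ≤ 1 := by
  rw [← hx.2.2]
  exact Finset.single_le_sum (fun i _ => hx.2.1 i) (Finset.mem_univ i)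

lemma isCompact_sorted (n : ℕ) : IsCompact {x : Fin n → ℝ | SortedProb x} := by
  refine (isCompact_univ_pi (fun _ : Fin n => isCompact_Icc (a := (0:ℝ)) (b := 1))).of_isClosed_subset
    ?_ ?_
  · simp only [SortedProb, Antitone, Set.ofPred_and, Set.ofPred_forall]
    refine IsClosed.inter ?_ (IsClosed.inter ?_ ?_)
    · refine isClosed_iInter fun a => isClosed_iInter fun b => isClosed_iInter fun _ => ?_
      exact isClosed_le (by fun_prop) (by fun_prop)
    · refine isClosed_iInter fun a => ?_
      exact isClosed_le (by fun_prop) (by fun_prop)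
    · exact isClosed_eq (by fun_prop) (by fun_prop)
  · intro x hx i _
    exact ⟨hx.2.1 i, sorted_le_one hx i⟩

lemma isCompact_unitary (n : ℕ) :
    IsCompact {U : Matrix (Fin n) (Fin n) ℂ | U ∈ Matrix.unitaryGroup (Fin n) ℂ} := by
  have hK : IsCompact {U : Matrix (Fin n) (Fin n) ℂ | ∀ i, U i ∈ {v : Fin n → ℂ | ∀ j, v j ∈ Metric.closedBall (0:ℂ) 1}} := by
    have h1 : IsCompact {v : Fin n → ℂ | ∀ j, v j ∈ Metric.closedBall (0:ℂ) 1} :=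
      isCompact_pi_infinite (fun _ => isCompact_closedBall 0 1)
    exact isCompact_pi_infinite (X := fun _ : Fin n => Fin n → ℂ) (fun _ => h1)
  refine hK.of_isClosed_subset ?_ ?_
  · simp only [Matrix.mem_unitaryGroup_iff', Matrix.star_eq_conjTranspose]
    exact isClosed_eq (by fun_prop) continuous_const
  · intro U hU i j
    simpa using unitary_entry hU i j

lemma isCompact_good (n : ℕ) :
    IsCompact {p : Matrix (Fin n) (Fin n) ℂ × (Fin n → ℝ) × (Fin n → ℝ) |
      GoodData p.1 p.2.1 p.2.2} := by
  refine ((isCompact_unitary n).prod ((isCompact_sorted n).prod (isCompact_sorted n))).inter_right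
    (t := {p | ∀ i j, i ≤ j → p.2.1 i * p.2.2 j ≤ p.2.1 j * p.2.2 i}) ?_ |>.of_isClosed_subset ?_ ?_
  · simp only [Set.ofPred_forall]
    refine isClosed_iInter fun a => isClosed_iInter fun b => isClosed_iInter fun _ => ?_
    exact isClosed_le (by fun_prop) (by fun_prop)
  · have e : {p : Matrix (Fin n) (Fin n) ℂ × (Fin n → ℝ) × (Fin n → ℝ) |
      GoodData p.1 p.2.1 p.2.2} = ({U : Matrix (Fin n) (Fin n) ℂ | U ∈ Matrix.unitaryGroup (Fin n) ℂ} ×ˢ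
        ({x : Fin n → ℝ | SortedProb x} ×ˢ {x : Fin n → ℝ | SortedProb x})) ∩
        {p | ∀ i j, i ≤ j → p.2.1 i * p.2.2 j ≤ p.2.1 j * p.2.2 i} := by
      ext p; simp [GoodData, and_assoc]
    rw [e]
    refine IsClosed.inter ?_ ?_
    · exact ((isCompact_unitary n).prod ((isCompact_sorted n).prod (isCompact_sorted n))).isClosed
    · simp only [Set.ofPred_forall]
      refine isClosed_iInter fun a => isClosed_iInter fun b => isClosed_iInter fun _ => ?_
      exact isClosed_le (by fun_prop) (by fun_prop)
  · intro p hp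
    exact ⟨⟨hp.1, hp.2.1, hp.2.2.1⟩, hp.2.2.2⟩

lemma isCompact_RR (n : ℕ) :
    IsCompact {p : Matrix (Fin n) (Fin n) ℂ × Matrix (Fin n) (Fin n) ℂ | RR p.1 p.2} := by
  have h := (isCompact_good n).image
    (f := fun p => (conjD p.1 p.2.1, conjD p.1 p.2.2)) (by unfold conjD; fun_prop)
  convert h using 1
  ext ⟨a, b⟩
  constructor
  · rintro ⟨U, x, y, hg, h1, h2⟩
    exact ⟨(U, x, y), hg, Prod.ext h1.symm h2.symm⟩
  · rintro ⟨⟨U, x, y⟩, hg, h1⟩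
    simp only [Prod.mk.injEq] at h1
    exact ⟨U, x, y, hg, h1.1.symm, h1.2.symm⟩

lemma RR_of_tendsto {n : ℕ} {a b : ℕ → Matrix (Fin n) (Fin n) ℂ} {a' b' : Matrix (Fin n) (Fin n) ℂ}
    (ha : Filter.Tendsto a Filter.atTop (nhds a')) (hb : Filter.Tendsto b Filter.atTop (nhds b'))
    (h : ∀ k, RR (a k) (b k)) : RR a' b' := by
  have := (isCompact_RR n).isClosed.mem_of_tendsto (ha.prodMk_nhds hb)
    (Filter.Eventually.of_forall h)
  exact this

lemma RR_density {n : ℕ} {a b : Matrix (Fin n) (Fin n) ℂ} (h : RR a b) :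
    IsDensityMatrix n a ∧ IsDensityMatrix n b := by
  obtain ⟨U, x, y, ⟨hU, hx, hy, hxy⟩, rfl, rfl⟩ := h
  exact ⟨conjD_isDensity hU hx, conjD_isDensity hU hy⟩

lemma qLE_iff {n : ℕ} (a b : QState n) : qLE a b ↔ RR a.1 b.1 :=
  ⟨RR_of_specLE a.2 b.2, specLE_of_RR⟩

lemma tendsto_of_NN {n : ℕ} {a b : ℕ → Matrix (Fin n) (Fin n) ℂ} {w : Matrix (Fin n) (Fin n) ℂ}
    (ha : Filter.Tendsto a Filter.atTop (nhds w))
    (h : Filter.Tendsto (fun k => NN (b k - a k)) Filter.atTop (nhds 0)) :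
    Filter.Tendsto b Filter.atTop (nhds w) := by
  have hd : Filter.Tendsto (fun k => b k - a k) Filter.atTop (nhds 0) := by
    refine tendsto_pi_nhds.2 fun i => tendsto_pi_nhds.2 fun j => ?_
    have h2 : Filter.Tendsto (fun k => ‖(b k - a k) i j‖ ^ 2) Filter.atTop (nhds 0) :=
      squeeze_zero (fun _ => by positivity) (fun k => entry_le_NN _ i j) h
    have h3 := h2.sqrt
    simp only [Real.sqrt_sq (norm_nonneg _), Real.sqrt_zero] at h3
    exact tendsto_zero_iff_norm_tendsto_zero.2 h3
  simpa using hd.add ha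

/-- A directed set with supremum ρ contains a sequence converging to ρ. -/
lemma exists_seq {n : ℕ} {ρ : QState n} {S : Set (QState n)} (hne : S.Nonempty)
    (hdir : DirectedOn qLE S) (hlub : IsLub' qLE S ρ) :
    ∃ u : ℕ → QState n, (∀ k, u k ∈ S) ∧
      Filter.Tendsto (fun k => (u k).1) Filter.atTop (nhds ρ.1) := by
  set T : Set ℝ := (fun s : QState n => NN s.1) '' S with hT
  have hTne : T.Nonempty := hne.image _
  have hTb : BddAbove T := by
    refine ⟨NN ρ.1, ?_⟩
    rintro _ ⟨s, hs, rfl⟩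
    have := RR_NN ((qLE_iff _ _).1 (hlub.1 s hs))
    have := NN_nonneg (ρ.1 - s.1)
    show NN s.1 ≤ _
    linarith
  have hex : ∀ k : ℕ, ∃ s ∈ S, sSup T - 1 / ((k : ℝ) + 1) < NN s.1 := by
    intro k
    have hk : (0:ℝ) < 1 / ((k : ℝ) + 1) := by positivity
    obtain ⟨_, ⟨s, hs, rfl⟩, h⟩ := exists_lt_of_lt_csSup hTne
      (show sSup T - 1 / ((k : ℝ) + 1) < sSup T by linarith)
    exact ⟨s, hs, h⟩
  choose u huS hu using hex
  haveI : FirstCountableTopology (Matrix (Fin n) (Fin n) ℂ) :=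
    inferInstanceAs (FirstCountableTopology (Fin n → Fin n → ℂ))
  obtain ⟨⟨w, w'⟩, hw, φ, hφ, hlim⟩ := (isCompact_RR n).tendsto_subseq
    (x := fun k => ((u k).1, ρ.1)) (fun k => (qLE_iff _ _).1 (hlub.1 _ (huS k)))
  have hlim1 : Filter.Tendsto (fun k => (u (φ k)).1) Filter.atTop (nhds w) :=
    (Prod.tendsto_iff _ _).1 hlim |>.1
  have hwρ : RR w ρ.1 := RR_of_tendsto hlim1 tendsto_const_nhds
    (fun k => (qLE_iff _ _).1 (hlub.1 _ (huS _)))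
  let W : QState n := ⟨w, (RR_density hwρ).1⟩
  have hub : ∀ s ∈ S, qLE s W := by
    intro s hs
    have : ∀ k, ∃ z ∈ S, qLE (u (φ k)) z ∧ qLE s z := fun k => hdir _ (huS _) _ hs
    choose z hzS hz1 hz2 using this
    refine (qLE_iff _ _).2 (RR_of_tendsto (b := fun k => (z k).1) tendsto_const_nhds ?_
      (fun k => (qLE_iff _ _).1 (hz2 k)))
    refine tendsto_of_NN hlim1 ?_
    refine squeeze_zero (fun _ => NN_nonneg _) (fun k => ?_)
      ((tendsto_one_div_add_atTop_nhds_zero_nat (𝕜 := ℝ)).comp hφ.tendsto_atTop)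
    have h1 := RR_NN ((qLE_iff _ _).1 (hz1 k))
    have h2 : NN (z k).1 ≤ sSup T := le_csSup hTb ⟨_, hzS k, rfl⟩
    have h3 := hu (φ k)
    simp only [Function.comp]
    linarith
  have hρw : RR ρ.1 w := (qLE_iff ρ W).1 (hlub.2 W hub)
  have : w = ρ.1 := RR_antisymm hwρ hρw
  exact ⟨fun k => u (φ k), fun k => huS _, this ▸ hlim1⟩

/-- mixing with the completely mixed state -/
noncomputable def mix {n : ℕ} (t : ℝ) (ρ : Matrix (Fin n) (Fin n) ℂ) : Matrix (Fin n) (Fin n) ℂ :=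
  (t : ℂ) • ρ + (((1 - t) / n : ℝ) : ℂ) • (1 : Matrix (Fin n) (Fin n) ℂ)

lemma mix_conjD {n : ℕ} {U : Matrix (Fin n) (Fin n) ℂ} (hU : U ∈ Matrix.unitaryGroup (Fin n) ℂ)
    (x : Fin n → ℝ) (t : ℝ) : mix t (conjD U x) = conjD U (fun i => t * x i + (1 - t) / n) := by
  apply conjD_of hU
  have h1 := unconj hU x
  have h2 := unit_left hU
  rw [mix, Matrix.mul_add, Matrix.add_mul, Matrix.mul_smul, Matrix.smul_mul, h1, Matrix.mul_smul,
    Matrix.smul_mul, Matrix.mul_one, h2]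
  ext i j
  by_cases hij : i = j
  · subst hij; simp
  · simp [hij]

lemma sorted_mix {n : ℕ} (hn : 2 ≤ n) {x : Fin n → ℝ} (hx : SortedProb x) {t : ℝ} (h0 : 0 ≤ t)
    (h1 : t ≤ 1) : SortedProb (fun i => t * x i + (1 - t) / n) := by
  have hn' : (0:ℝ) < n := by exact_mod_cast (by omega : 0 < n)
  refine ⟨fun i j hij => ?_, fun i => ?_, ?_⟩
  · have := mul_le_mul_of_nonneg_left (hx.1 hij) h0
    show t * x j + _ ≤ t * x i + _
    linarith
  · have := hx.2.1 i
    have : 0 ≤ (1 - t) / n := div_nonneg (by linarith) hn'.le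
    positivity
  · rw [Finset.sum_add_distrib, ← Finset.mul_sum, hx.2.2]
    simp
    field_simp
    ring

lemma mix_density {n : ℕ} (hn : 2 ≤ n) {ρ : Matrix (Fin n) (Fin n) ℂ} (hρ : IsDensityMatrix n ρ)
    {t : ℝ} (h0 : 0 ≤ t) (h1 : t ≤ 1) : IsDensityMatrix n (mix t ρ) := by
  obtain ⟨U, x, y, ⟨hU, hx, hy, hxy⟩, rfl, -⟩ := RR_refl hρ
  rw [mix_conjD hU]
  exact conjD_isDensity hU (sorted_mix hn hx h0 h1)

lemma RR_mix_mono {n : ℕ} (hn : 2 ≤ n) {ρ τ : Matrix (Fin n) (Fin n) ℂ} (hρ : IsDensityMatrix n ρ)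
    {t t' : ℝ} (h0 : 0 < t) (htt : t ≤ t') (h1 : t' ≤ 1) (h : RR τ (mix t ρ)) :
    RR τ (mix t' ρ) := by
  have hn' : (0:ℝ) < n := by exact_mod_cast (by omega : 0 < n)
  have hd := mix_density hn hρ (h0.le.trans htt) h1
  obtain ⟨U, x, y, ⟨hU, hx, hy, hxy⟩, rfl, h2⟩ := h
  set a : ℝ := t' / t with ha
  set b : ℝ := a * ((1 - t) / n) - (1 - t') / n with hb
  have ha1 : 1 ≤ a := by rw [ha, le_div_iff₀ h0]; linarith
  have hb0 : 0 ≤ b := by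
    rw [hb, ← mul_div_assoc, ← sub_div]
    apply div_nonneg _ hn'.le
    nlinarith
  have e : mix t' ρ = conjD U (fun i => a * y i - b) := by
    have e1 : mix t' ρ = (a : ℂ) • mix t ρ - (b : ℂ) • (1 : Matrix (Fin n) (Fin n) ℂ) := by
      have : (a : ℂ) * t = t' := by
        rw [← Complex.ofReal_mul, ha, div_mul_cancel₀ _ h0.ne']
      rw [mix, mix, smul_add, smul_smul, smul_smul, this, add_sub_assoc, ← sub_smul, hb]
      congr 2
      push_cast; ring
    apply conjD_of hU
    have h3 := unconj hU y
    have h4 := unit_left hU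
    rw [e1, h2, Matrix.mul_sub, Matrix.sub_mul, Matrix.mul_smul, Matrix.smul_mul, h3, Matrix.mul_smul,
      Matrix.smul_mul, Matrix.mul_one, h4]
    ext i j
    by_cases hij : i = j
    · subst hij; simp
    · simp [hij]
  have hs : SortedProb (fun i => a * y i - b) := by
    have e2 := unconj hU (fun i => a * y i - b)
    rw [← e] at e2
    have := (sorted_conj hd hU (by rw [e2]; exact Matrix.isDiag_diagonal _) (by
      rw [e2]
      intro i j hij
      have := mul_le_mul_of_nonneg_left (hy.1 hij) (by linarith : 0 ≤ a)
      simp only [Matrix.diagonal_apply_eq, Complex.ofReal_re]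
      linarith)).1
    rw [e2] at this
    simpa using this
  refine ⟨U, x, _, ⟨hU, hx, hs, fun i j hij => ?_⟩, rfl, e⟩
  have q1 := mul_le_mul_of_nonneg_left (hxy i j hij) (by linarith : 0 ≤ a)
  have q2 := mul_le_mul_of_nonneg_left (hx.1 hij) hb0
  nlinarith

lemma finite_gap {F : Set ℂ} (hF : F.Finite) :
    ∃ δ : ℝ, 0 < δ ∧ ∀ a ∈ F, ∀ b ∈ F, a ≠ b → δ ≤ ‖a - b‖ := by
  have hG : ((F ×ˢ F) \ {p | p.1 = p.2}).Finite := (hF.prod hF).sdiff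
  rcases ((F ×ˢ F) \ {p | p.1 = p.2}).eq_empty_or_nonempty with h | h
  · refine ⟨1, one_pos, fun a ha b hb hab => ?_⟩
    have : (a, b) ∈ (F ×ˢ F) \ {p | p.1 = p.2} := ⟨⟨ha, hb⟩, hab⟩
    rw [h] at this; exact this.elim
  · obtain ⟨p, hp, hmin⟩ := hG.exists_minimalFor (fun p : ℂ × ℂ => ‖p.1 - p.2‖) _ h
    refine ⟨‖p.1 - p.2‖, norm_pos_iff.2 (sub_ne_zero.2 hp.2), fun a ha b hb hab => ?_⟩
    by_contra hc
    push Not at hc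
    exact absurd (hmin (j := (a, b)) ⟨⟨ha, hb⟩, hab⟩ hc.le) (not_le.2 hc)

lemma mem_spec {n : ℕ} {U : Matrix (Fin n) (Fin n) ℂ} (hU : U ∈ Matrix.unitaryGroup (Fin n) ℂ)
    (x : Fin n → ℝ) (i : Fin n) : (x i : ℂ) ∈ {z : ℂ | (conjD U x).charpoly.IsRoot z} := by
  have h : (conjD U x).charpoly = (Matrix.diagonal (fun i => (x i : ℂ))).charpoly := by
    rw [conjD, Matrix.charpoly_mul_comm, ← Matrix.mul_assoc, unit_left hU, Matrix.one_mul]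
  show (conjD U x).charpoly.IsRoot _
  rw [h, Matrix.charpoly_diagonal, Polynomial.IsRoot.def, Polynomial.eval_prod]
  exact Finset.prod_eq_zero (Finset.mem_univ i) (by simp)

lemma eig_close {n : ℕ} {U : Matrix (Fin n) (Fin n) ℂ} (hU : U ∈ Matrix.unitaryGroup (Fin n) ℂ)
    (x y : Fin n → ℝ) (i : Fin n) :
    |x i - y i| ≤ ∑ j, ∑ k, ‖conjD U x j k - conjD U y j k‖ := by
  have h : (Uᴴ * (conjD U x - conjD U y) * U) i i = ((x i - y i : ℝ) : ℂ) := by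
    rw [Matrix.mul_sub, Matrix.sub_mul, unconj hU, unconj hU]; simp
  have : |x i - y i| = ‖(Uᴴ * (conjD U x - conjD U y) * U) i i‖ := by
    rw [h, Complex.norm_real, Real.norm_eq_abs]
  rw [this, Matrix.mul_apply, Finset.sum_comm]
  refine (norm_sum_le _ _).trans (Finset.sum_le_sum fun k _ => ?_)
  rw [norm_mul, Matrix.mul_apply]
  have a1 := unitary_entry hU k i
  refine (mul_le_of_le_one_right (norm_nonneg _) a1).trans ?_
  refine (norm_sum_le _ _).trans (Finset.sum_le_sum fun j _ => ?_)
  rw [norm_mul, Matrix.conjTranspose_apply, norm_star]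
  exact mul_le_of_le_one_left (norm_nonneg _) (unitary_entry hU j i)

lemma near {n : ℕ} (hn : 2 ≤ n) {ρ : Matrix (Fin n) (Fin n) ℂ} {t : ℝ} (h0 : 0 < t) (h1 : t < 1) :
    ∃ ε > 0, ∀ s, RR s ρ → ∑ j, ∑ k, ‖s j k - ρ j k‖ < ε → RR (mix t ρ) s := by
  have hn' : (0:ℝ) < n := by exact_mod_cast (by omega : 0 < n)
  have hF : {z : ℂ | ρ.charpoly.IsRoot z}.Finite :=
    Polynomial.finite_setOfPred_isRoot ρ.charpoly_monic.ne_zero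
  obtain ⟨δ, hδ, hgap⟩ := finite_gap hF
  set c : ℝ := (1 - t) / n with hc
  have hc0 : 0 < c := div_pos (by linarith) hn'
  refine ⟨c * δ / (2 + 2 * c), by positivity, ?_⟩
  intro s hs hlt
  obtain ⟨U, x, y, ⟨hU, hx, hy, hxy⟩, rfl, rfl⟩ := hs
  set e := c * δ / (2 + 2 * c) with he
  have hee : e * (2 + 2 * c) = c * δ := by rw [he]; field_simp
  have he0 : 0 < e := by positivity
  rw [mix_conjD hU]
  refine ⟨U, _, x, ⟨hU, sorted_mix hn hy h0.le h1.le, hx, fun i j hij => ?_⟩, rfl, rfl⟩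
  show (t * y i + c) * x j ≤ (t * y j + c) * x i
  by_cases heq : y i = y j
  · rw [heq]
    exact mul_le_mul_of_nonneg_left (hx.1 hij) (by have := hy.2.1 j; positivity)
  · have g := hgap _ (mem_spec hU y i) _ (mem_spec hU y j) (by exact_mod_cast heq)
    rw [← Complex.ofReal_sub, Complex.norm_real, Real.norm_eq_abs,
      abs_of_nonneg (sub_nonneg.2 (hy.1 hij))] at g
    have bi := abs_le.1 ((eig_close hU x y i).trans hlt.le)
    have bj := abs_le.1 ((eig_close hU x y j).trans hlt.le)
    have yi := sorted_le_one hy i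
    have yj := sorted_le_one hy j
    have yi0 := hy.2.1 i
    have yj0 := hy.2.1 j
    have m1 : y i * (x j - y j) ≤ e := by nlinarith
    have m2 : -e ≤ y j * (x i - y i) := by nlinarith
    have m3 : t * (y i * x j - y j * x i) ≤ 2 * e := by
      have : y i * x j - y j * x i ≤ 2 * e := by nlinarith
      nlinarith
    have m4 : c * (δ - 2 * e) ≤ c * (x i - x j) :=
      mul_le_mul_of_nonneg_left (by linarith [bi.1, bj.2]) hc0.le
    nlinarith

lemma mix_wayBelow {n : ℕ} (hn : 2 ≤ n) (ρ τ : QState n) {t : ℝ} (h0 : 0 < t) (h1 : t < 1)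
    (hτ : τ.1 = mix t ρ.1) : WayBelow qLE τ ρ := by
  intro S hne hdir hlub
  obtain ⟨u, huS, hu⟩ := exists_seq hne hdir hlub
  obtain ⟨ε, hε, h⟩ := near hn (ρ := ρ.1) h0 h1
  have hcont : Continuous (fun M : Matrix (Fin n) (Fin n) ℂ => ∑ j, ∑ k, ‖M j k - ρ.1 j k‖) := by
    refine continuous_finsetSum _ fun j _ => continuous_finsetSum _ fun k _ => ?_
    exact ((continuous_id.matrix_elem j k).sub continuous_const).norm
  have hl := (hcont.tendsto ρ.1).comp hu
  simp only [sub_self, norm_zero, Finset.sum_const_zero] at hl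
  obtain ⟨k, hk⟩ := (hl.eventually (gt_mem_nhds hε)).exists
  exact ⟨u k, huS k, (qLE_iff _ _).2 (hτ ▸ h _ ((qLE_iff _ _).1 (hlub.1 _ (huS k))) hk)⟩

lemma mix_one {n : ℕ} (ρ : Matrix (Fin n) (Fin n) ℂ) : mix 1 ρ = ρ := by simp [mix]

/-- (Ωⁿ, ⊑) is exact: for every ρ, ⇓ρ is directed with supremum ρ. -/
theorem quantum_states_exact (n : ℕ) (hn : 2 ≤ n) (ρ : QState n) :
    {τ : QState n | WayBelow qLE τ ρ}.Nonempty ∧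
    DirectedOn qLE {τ : QState n | WayBelow qLE τ ρ} ∧
    IsLub' qLE {τ : QState n | WayBelow qLE τ ρ} ρ := by
  let T : Set (QState n) := {τ | ∃ t : ℝ, 0 < t ∧ t < 1 ∧ τ.1 = mix t ρ.1}
  have hTw : ∀ τ ∈ T, WayBelow qLE τ ρ := by
    rintro τ ⟨t, h0, h1, h⟩
    exact mix_wayBelow hn ρ τ h0 h1 h
  have hmk : ∀ t : ℝ, 0 < t → t < 1 → ∃ τ ∈ T, τ.1 = mix t ρ.1 := fun t h0 h1 =>
    ⟨⟨mix t ρ.1, mix_density hn ρ.2 h0.le h1.le⟩, ⟨t, h0, h1, rfl⟩, rfl⟩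
  have hTne : T.Nonempty := by
    obtain ⟨τ, h, -⟩ := hmk (1/2) (by norm_num) (by norm_num)
    exact ⟨τ, h⟩
  -- two elements below members of T have a common bound in T
  have hT2 : ∀ a b : QState n, ∀ s ∈ T, ∀ s' ∈ T, qLE a s → qLE b s' →
      ∃ z ∈ T, qLE a z ∧ qLE b z := by
    rintro a b s ⟨t, h0, h1, h⟩ s' ⟨t', h0', h1', h'⟩ ha hb
    rw [qLE_iff] at ha hb
    rw [h] at ha
    rw [h'] at hb
    obtain ⟨z, hz, hze⟩ := hmk (max t t') (lt_max_of_lt_left h0) (max_lt h1 h1')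
    refine ⟨z, hz, ?_, ?_⟩
    · rw [qLE_iff, hze]
      exact RR_mix_mono hn ρ.2 h0 (le_max_left _ _) (max_lt h1 h1').le ha
    · rw [qLE_iff, hze]
      exact RR_mix_mono hn ρ.2 h0' (le_max_right _ _) (max_lt h1 h1').le hb
  have hrefl : ∀ a : QState n, qLE a a := fun a => (qLE_iff _ _).2 (RR_refl a.2)
  have hTdir : DirectedOn qLE T := fun a ha b hb => hT2 a b a ha b hb (hrefl a) (hrefl b)
  have hTub : ∀ s ∈ T, qLE s ρ := by
    rintro s ⟨t, h0, h1, h⟩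
    have := RR_mix_mono hn ρ.2 h0 h1.le le_rfl (h ▸ RR_refl s.2 : RR s.1 (mix t ρ.1))
    rw [mix_one] at this
    exact (qLE_iff _ _).2 this
  have hTleast : ∀ b, (∀ s ∈ T, qLE s b) → qLE ρ b := by
    intro b hb
    rw [qLE_iff]
    have htt : Filter.Tendsto (fun k : ℕ => 1 - 1 / ((k : ℝ) + 2)) Filter.atTop (nhds 1) := by
      have := ((tendsto_one_div_add_atTop_nhds_zero_nat (𝕜 := ℝ)).comp (Filter.tendsto_add_atTop_nat 1)).const_sub 1
      simp only [sub_zero] at this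
      refine this.congr fun k => ?_
      simp only [Function.comp]; push_cast; ring
    have hc : Continuous (fun t : ℝ => mix t ρ.1) := by
      unfold mix; fun_prop
    have hl := (hc.tendsto 1).comp htt
    rw [mix_one] at hl
    refine RR_of_tendsto (b := fun _ => b.1) hl tendsto_const_nhds fun k => ?_
    have hk : (0:ℝ) < 1 / ((k : ℝ) + 2) := by positivity
    have hk2 : 1 / ((k : ℝ) + 2) < 1 := by
      rw [div_lt_one (by positivity)]; have : (0:ℝ) ≤ k := by positivity
      linarith
    obtain ⟨s, hs, hse⟩ := hmk (1 - 1 / ((k : ℝ) + 2)) (by linarith) (by linarith)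
    have := (qLE_iff _ _).1 (hb s hs)
    rw [hse] at this
    exact this
  have hbelow : ∀ τ, WayBelow qLE τ ρ → ∃ s ∈ T, qLE τ s := fun τ h =>
    h T hTne hTdir ⟨hTub, hTleast⟩
  refine ⟨?_, ?_, ?_, ?_⟩
  · obtain ⟨τ, h⟩ := hTne
    exact ⟨τ, hTw τ h⟩
  · intro a ha b hb
    obtain ⟨s, hs, h⟩ := hbelow a ha
    obtain ⟨s', hs', h'⟩ := hbelow b hb
    obtain ⟨z, hz, hz1, hz2⟩ := hT2 a b s hs s' hs' h h'
    exact ⟨z, hTw z hz, hz1, hz2⟩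
  · intro τ hτ
    obtain ⟨s, hs, h⟩ := hτ {ρ} (Set.singleton_nonempty ρ)
      (by rintro a rfl b rfl; exact ⟨b, rfl, hrefl b, hrefl b⟩)
      ⟨by rintro a rfl; exact hrefl a, fun b hb => hb ρ rfl⟩
    rw [Set.mem_singleton_iff] at hs
    exact hs ▸ h
  · intro b hb
    exact hTleast b fun s hs => hb s (hTw s hs)
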